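/- Let 0 < κ ≤ 1/12. There exist a universal constant C₀ > 0 and λ₀ > 0 such that for all 0 < λ ≤ λ₀ and every η with λ^{2+4κ} ≤ η ≤ λ², one has: (i) sup_{α ∈ ℝ} ∫_{𝕋³} λ² dp / |α − ω̄(p) − iη|² ≤ 1 + C₀ λ^{1−12κ}; and (ii) sup_{α, β ∈ ℝ, r ∈ 𝕋³} ∫_{𝕋³} λ² dp / ( |α − ω̄(p+r) − iη| · |β − ω(p−r) + iη| ) ≤ 1 + C₀ λ^{1−12κ}. -/

import Mathlib

open MeasureTheory Filter Topology

noncomputable section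

/-- The torus `𝕋³ = [-1/2, 1/2]³` realized as a box in `ℝ³`. -/
def T3 : Set (Fin 3 → ℝ) := Set.pi Set.univ fun _ => Set.Icc (-(1/2) : ℝ) (1/2)

/-- The lattice dispersion relation `e(p) = ∑_j (1 - cos(2π p_j))`. -/
def edisp (p : Fin 3 → ℝ) : ℝ := ∑ j, (1 - Real.cos (2 * Real.pi * p j))

/-- `Θ_ε(α) = ∫_{𝕋³} dq / (α - e(q) + iε)`. -/
def ThetaEps (ε α : ℝ) : ℂ := ∫ q in T3, ((α : ℂ) - (edisp q : ℂ) + (ε : ℂ) * Complex.I)⁻¹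

/-- `Θ` is the limit of `Θ_ε` as `ε → 0⁺`. -/
def IsThetaLimit (Θ : ℝ → ℂ) : Prop :=
  ∀ α : ℝ, Tendsto (fun ε => ThetaEps ε α) (𝓝[>] (0 : ℝ)) (𝓝 (Θ α))

/-- The renormalized dispersion `ω(p) = e(p) + λ² Θ(e(p))`. -/
def omegaR (Θ : ℝ → ℂ) (lam : ℝ) (p : Fin 3 → ℝ) : ℂ :=
  (edisp p : ℂ) + (lam : ℂ) ^ 2 * Θ (edisp p)

/-- A function on `𝕋³`, i.e. a `ℤ³`-periodic function on `ℝ³`. -/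
def ZPeriodic (g : (Fin 3 → ℝ) → ℂ) : Prop :=
  ∀ (p : Fin 3 → ℝ) (n : Fin 3 → ℤ), g (p + fun j => (n j : ℝ)) = g p

/-- The `C¹` norm `‖g‖_∞ + ‖∇g‖_∞`. -/
def C1Norm (g : (Fin 3 → ℝ) → ℂ) : ℝ :=
  (⨆ p : Fin 3 → ℝ, ‖g p‖) + ⨆ p : Fin 3 → ℝ, ‖fderiv ℝ g p‖

/-- `|||α||| = min {|α|, |α-2|, |α-3|, |α-4|, |α-6|}`. -/
def anorm (a : ℝ) : ℝ := min (min (min |a| |a - 2|) (min |a - 3| |a - 4|)) |a - 6|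

/-- Distance between two points of the circle `ℝ/ℤ`. -/
def cdist (x y : ℝ) : ℝ := |x - y - (round (x - y) : ℝ)|

/-- `|||q||| = η + min {dist(q, γ) : γ a critical point of e}` (torus distance);
the critical points are exactly the points with all coordinates in `{0, 1/2}` mod `1`,
and minimizing over them coordinatewise gives the formula below. -/
def tnorm (η : ℝ) (q : Fin 3 → ℝ) : ℝ :=
  η + Real.sqrt (∑ j, (min (cdist (q j) 0) (cdist (q j) (1/2))) ^ 2)

/-- `|∇e(q)|`, the Euclidean length of the gradient of the dispersion relation. -/
def gradNorm (q : Fin 3 → ℝ) : ℝ := Real.sqrt (∑ j, (2 * Real.pi * Real.sin (2 * Real.pi * q j)) ^ 2)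



lemma inv_lorentz_int (s c : ℝ) (hs : 0 < s) :
    Integrable (fun p : ℝ => 1 / (16 * (p - c)^2 + s^2)) ∧
    ∫ p : ℝ, 1 / (16 * (p - c)^2 + s^2) ≤ 1 / s := by
  have hs' : (4 / s) ≠ 0 := by positivity
  have key : (fun p : ℝ => 1 / (16 * (p - c)^2 + s^2)) =
      fun p => (fun x : ℝ => (1/s^2) * (fun y : ℝ => (1 + y^2)⁻¹) (x * (4/s))) (p - c) := by
    funext p
    have : 0 < 16 * (p - c)^2 + s^2 := by positivity
    have h2 : 0 < 1 + ((p - c) * (4/s))^2 := by positivity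
    simp only
    field_simp
    ring
  have hi : Integrable (fun x : ℝ => (1/s^2) * (fun y : ℝ => (1 + y^2)⁻¹) (x * (4/s))) :=
    (integrable_inv_one_add_sq.comp_mul_right' hs').const_mul _
  refine ⟨by rw [key]; exact hi.comp_sub_right c, ?_⟩
  rw [key, integral_sub_right_eq_self (fun x : ℝ => (1/s^2) * (fun y : ℝ => (1 + y^2)⁻¹) (x * (4/s))) c,
    integral_const_mul, Measure.integral_comp_mul_right (fun y : ℝ => (1 + y^2)⁻¹), integral_univ_inv_one_add_sq]
  have hpi := Real.pi_le_four
  rw [abs_of_pos (by positivity), smul_eq_mul]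
  have : 1 / s^2 * ((4/s)⁻¹ * Real.pi) = (Real.pi/4) * (1/s) := by field_simp
  rw [this]
  have : 0 < 1/s := by positivity
  nlinarith

lemma sin_ge (p c : ℝ) (n : ℤ) (hc : c = n / 2) (h : |p - c| ≤ 1/4) (s : ℝ) (hs : 0 < s) :
    1 / (Real.sin (2 * Real.pi * p)^2 + s^2) ≤ 1 / (16 * (p - c)^2 + s^2) := by
  have hpi := Real.pi_pos
  have h1 : |2 * Real.pi * (p - c)| ≤ Real.pi / 2 := by
    rw [abs_mul, abs_of_pos (by positivity)]; nlinarith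
  have h2 := Real.mul_abs_le_abs_sin h1
  have h3 : Real.sin (2 * Real.pi * (p - c)) ^ 2 = Real.sin (2 * Real.pi * p)^2 := by
    have : 2 * Real.pi * (p - c) = 2 * Real.pi * p - n * Real.pi := by rw [hc]; ring
    rw [this, Real.sin_sub_int_mul_pi, mul_pow, ← zpow_natCast, ← zpow_mul, mul_comm n, zpow_mul]
    simp
  have h4 : 2 / Real.pi * |2 * Real.pi * (p - c)| = 4 * |p - c| := by
    rw [abs_mul, abs_of_pos (by positivity : 0 < 2 * Real.pi)]; field_simp; ring
  rw [h4] at h2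
  have h5 : (4 * |p - c|)^2 ≤ |Real.sin (2 * Real.pi * (p - c))|^2 := by gcongr
  rw [sq_abs, h3, mul_pow, sq_abs] at h5
  apply one_div_le_one_div_of_le (by positivity)
  linarith

lemma sin_int (s : ℝ) (hs : 0 < s) :
    ∫ p in (-(1/2) : ℝ)..(1/2), 1 / (Real.sin (2 * Real.pi * p)^2 + s^2) ≤ 3 / s := by
  obtain ⟨i1, j1⟩ := inv_lorentz_int s (-(1/2)) hs
  obtain ⟨i2, j2⟩ := inv_lorentz_int s 0 hs
  obtain ⟨i3, j3⟩ := inv_lorentz_int s (1/2) hs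
  rw [intervalIntegral.integral_of_le (by norm_num)]
  have hsum := (i1.add i2).add i3
  calc _ ≤ ∫ p in Set.Ioc (-(1/2) : ℝ) (1/2), ((1 / (16 * (p - (-(1/2)))^2 + s^2) +
        1 / (16 * (p - 0)^2 + s^2)) + 1 / (16 * (p - 1/2)^2 + s^2)) := by
        apply integral_mono_of_nonneg
        · exact Eventually.of_forall fun p => by positivity
        · exact hsum.integrableOn
        · filter_upwards [ae_restrict_mem measurableSet_Ioc] with p hp
          have q1 : 0 ≤ 1 / (16 * (p - (-(1/2)))^2 + s^2) := by positivity
          have q2 : 0 ≤ 1 / (16 * (p - 0)^2 + s^2) := by positivity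
          have q3 : 0 ≤ 1 / (16 * (p - 1/2)^2 + s^2) := by positivity
          obtain ⟨ha, hb⟩ := hp
          by_cases c1 : p ≤ -(1/4)
          · have := sin_ge p (-(1/2)) (-1) (by norm_num) (by rw [abs_le]; constructor <;> linarith) s hs
            linarith
          by_cases c2 : p ≤ 1/4
          · have := sin_ge p 0 0 (by norm_num) (by rw [abs_le]; constructor <;> linarith) s hs
            linarith
          · have := sin_ge p (1/2) 1 (by norm_num) (by rw [abs_le]; constructor <;> linarith) s hs
            linarith
    _ ≤ ∫ p : ℝ, ((1 / (16 * (p - (-(1/2)))^2 + s^2) +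
        1 / (16 * (p - 0)^2 + s^2)) + 1 / (16 * (p - 1/2)^2 + s^2)) := by
        apply setIntegral_le_integral hsum
        exact Eventually.of_forall fun p => by simp only [Pi.zero_apply, Pi.add_apply]; positivity
    _ ≤ 3 / s := by
        rw [integral_add (by exact i1.add i2) i3, integral_add i1 i2]
        have : 3 / s = 1/s + 1/s + 1/s := by ring
        linarith

/-- the one-dimensional oscillating integrand -/
def osc (t p : ℝ) : ℂ := Complex.exp (-(Complex.I * t) * ((1 - Real.cos (2 * Real.pi * p) : ℝ) : ℂ))

lemma osc_norm (t p : ℝ) : ‖osc t p‖ = 1 := by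
  rw [osc, Complex.norm_exp]; simp [-Complex.ofReal_cos, -Complex.ofReal_sub]

lemma osc_deriv (t p : ℝ) :
    HasDerivAt (osc t) (osc t p * (-(Complex.I * t) * ((2 * Real.pi * Real.sin (2 * Real.pi * p) : ℝ) : ℂ))) p := by
  have h1 : HasDerivAt (fun p : ℝ => 1 - Real.cos (2 * Real.pi * p)) (2 * Real.pi * Real.sin (2 * Real.pi * p)) p := by
    have := ((hasDerivAt_id p).const_mul (2 * Real.pi)).cos.const_sub 1
    exact this.congr_deriv (by simp only [id_eq, mul_one]; ring)
  exact (h1.ofReal_comp.const_mul (-(Complex.I * t))).cexp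

lemma osc_cont (t : ℝ) : Continuous (osc t) := by
  unfold osc; fun_prop

lemma osc_bound (t : ℝ) (ht : 0 < t) :
    ‖∫ p in (-(1/2) : ℝ)..(1/2), osc t p‖ ≤ 6 / Real.sqrt t := by
  obtain ⟨s, hs, hst⟩ : ∃ s : ℝ, 0 < s ∧ s^2 = 1 / t :=
    ⟨Real.sqrt (1/t), by positivity, Real.sq_sqrt (by positivity)⟩
  have hts : t * s^2 = 1 := by rw [hst]; field_simp
  have hsq : Real.sqrt t = 1 / s := by
    rw [Real.sqrt_eq_iff_mul_self_eq ht.le (by positivity)]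
    field_simp; linarith
  have hpi := Real.pi_pos
  set S : ℝ → ℝ := fun p => Real.sin (2 * Real.pi * p) with hS
  set C : ℝ → ℝ := fun p => Real.cos (2 * Real.pi * p) with hC
  have hScont : Continuous S := by rw [hS]; fun_prop
  have hCcont : Continuous C := by rw [hC]; fun_prop
  have hD : ∀ p, 0 < S p ^ 2 + s^2 := fun p => by positivity
  have hD' : ∀ p, S p ^ 2 + s^2 ≠ 0 := fun p => (hD p).ne'
  have hu : ∀ p, HasDerivAt (fun p => S p / (S p ^ 2 + s^2))
      (2 * Real.pi * C p * (s^2 - S p ^2) / (S p ^2 + s^2)^2) p := by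
    intro p
    have h1 : HasDerivAt S (2 * Real.pi * C p) p := by
      have := ((hasDerivAt_id p).const_mul (2 * Real.pi)).sin
      exact this.congr_deriv (by simp only [id_eq, mul_one, hC]; ring)
    exact (h1.div ((h1.pow 2).add_const (s^2)) (hD' p)).congr_deriv (by simp; ring)
  set u' : ℝ → ℝ := fun p => 2 * Real.pi * C p * (s^2 - S p ^2) / (S p ^2 + s^2)^2 with hu'
  have hu'c : Continuous u' := by
    rw [hu']
    exact Continuous.div (by fun_prop) (by fun_prop) (fun p => pow_ne_zero _ (hD' p))
  have hDc : Continuous (fun p => 1 / (S p ^2 + s^2)) :=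
    Continuous.div (by fun_prop) (by fun_prop) hD'
  have huc : Continuous (fun p => S p / (S p ^ 2 + s^2)) :=
    Continuous.div (by fun_prop) (by fun_prop) hD'
  set W : ℝ → ℂ := fun p => (osc t p * (-(Complex.I * t) * ((2 * Real.pi * S p : ℝ) : ℂ))) *
      ((S p / (S p ^ 2 + s^2) : ℝ) : ℂ) + osc t p * (u' p : ℂ) with hW
  have hoc := osc_cont t
  have hWc : Continuous W := by
    rw [hW]
    have h1 := Complex.continuous_ofReal.comp huc
    have h2 := Complex.continuous_ofReal.comp hu'c
    have h3 : Continuous (fun p => ((2 * Real.pi * S p : ℝ) : ℂ)) := by fun_prop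
    exact (((hoc.mul (continuous_const.mul h3))).mul h1).add (hoc.mul h2)
  have hWint : ∫ p in (-(1/2) : ℝ)..(1/2), W p = 0 := by
    rw [intervalIntegral.integral_eq_sub_of_hasDerivAt
      (f := fun p => osc t p * ((S p / (S p ^ 2 + s^2) : ℝ) : ℂ))
      (fun p _ => (osc_deriv t p).mul (hu p).ofReal_comp) (hWc.intervalIntegrable _ _)]
    have e1 : S (1/2) = 0 := by
      simp only [hS]; rw [show 2 * Real.pi * (1/2) = Real.pi by ring]; exact Real.sin_pi
    have e2 : S (-(1/2)) = 0 := by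
      simp only [hS]; rw [show 2 * Real.pi * (-(1/2)) = -Real.pi by ring]; simp
    rw [e1, e2]; simp
  set R : ℝ → ℂ := fun p => osc t p * ((2 * Real.pi * t * s^2 / (S p^2 + s^2) : ℝ) * Complex.I
      + (u' p : ℂ)) with hR
  have hRW : ∀ p, (2 * Real.pi * t * Complex.I : ℂ) * osc t p = R p - W p := by
    intro p
    simp only [hR, hW]
    have : ((S p : ℂ)^2 + (s:ℂ)^2) ≠ 0 := by exact_mod_cast hD' p
    push_cast
    field_simp
    ring
  have hRc : Continuous R := by
    have : R = fun p => (2 * Real.pi * t * Complex.I : ℂ) * osc t p + W p := by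
      funext p; rw [hRW]; ring
    rw [this]; fun_prop
  have hu'b : ∀ p, |u' p| ≤ 2 * Real.pi / (S p^2 + s^2) := by
    intro p
    simp only [hu']
    have hd := hD p
    rw [abs_div, abs_of_pos (by positivity : 0 < (S p^2 + s^2)^2), abs_mul, abs_mul,
      abs_of_pos (by positivity : 0 < 2 * Real.pi), div_le_div_iff₀ (by positivity) hd]
    have c1 : |C p| ≤ 1 := Real.abs_cos_le_one _
    have c2 : |s^2 - S p^2| ≤ S p ^2 + s^2 := by
      rw [abs_le]; constructor <;> nlinarith [sq_nonneg (S p), sq_nonneg s]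
    have c3 : |C p| * |s^2 - S p^2| ≤ 1 * (S p ^2 + s^2) := by gcongr
    nlinarith [mul_le_mul_of_nonneg_left c3 (by positivity : 0 ≤ 2 * Real.pi * (S p^2 + s^2))]
  have hRb : ∀ p, ‖R p‖ ≤ 4 * Real.pi * (1 / (S p^2 + s^2)) := by
    intro p
    simp only [hR]
    rw [norm_mul, osc_norm, one_mul]
    refine (norm_add_le _ _).trans ?_
    rw [norm_mul, Complex.norm_I, mul_one, Complex.norm_real, Complex.norm_real, Real.norm_eq_abs,
      Real.norm_eq_abs]
    have hd := hD p
    have e : 2 * Real.pi * t * s^2 = 2 * Real.pi := by rw [mul_assoc, hts, mul_one]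
    rw [e, abs_of_pos (by positivity)]
    have := hu'b p
    have e2 : 4 * Real.pi * (1 / (S p^2 + s^2)) =
      2 * Real.pi / (S p^2 + s^2) + 2 * Real.pi / (S p^2 + s^2) := by ring
    linarith
  have hfin : (2 * Real.pi * t * Complex.I : ℂ) * ∫ p in (-(1/2) : ℝ)..(1/2), osc t p =
      ∫ p in (-(1/2) : ℝ)..(1/2), R p := by
    rw [← intervalIntegral.integral_const_mul]
    simp_rw [hRW]
    rw [intervalIntegral.integral_sub (hRc.intervalIntegrable _ _) (hWc.intervalIntegrable _ _),
      hWint, sub_zero]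
  have hn : ‖∫ p in (-(1/2) : ℝ)..(1/2), R p‖ ≤ 4 * Real.pi * (3 / s) := by
    refine (intervalIntegral.norm_integral_le_of_norm_le (by norm_num)
      (Eventually.of_forall fun p _ => hRb p) ((hDc.const_mul _).intervalIntegrable _ _)).trans ?_
    rw [intervalIntegral.integral_const_mul]
    exact mul_le_mul_of_nonneg_left (sin_int s hs) (by positivity)
  rw [← hfin, norm_mul] at hn
  have hc : ‖(2 * Real.pi * t * Complex.I : ℂ)‖ = 2 * Real.pi * t := by
    simp [abs_of_pos ht, abs_of_pos hpi]
  rw [hc] at hn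
  rw [hsq]
  have e3 : 4 * Real.pi * (3 / s) = 2 * Real.pi * t * (6 * s) := by
    field_simp; linarith
  rw [e3] at hn
  have := le_of_mul_le_mul_left hn (by positivity)
  calc _ ≤ 6 * s := this
    _ = _ := by field_simp

lemma edisp_cont : Continuous edisp := by
  unfold edisp; fun_prop

instance T3_prob : IsProbabilityMeasure (volume.restrict T3) := by
  constructor
  rw [Measure.restrict_apply_univ, T3, volume_pi_pi]
  simp
  norm_num

/-- Fourier transform of the density of states. -/
def Kf (t : ℝ) : ℂ := ∫ p in T3, Complex.exp (-(Complex.I * t) * (edisp p : ℂ))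

lemma Kf_eq (t : ℝ) : Kf t = (∫ p in (-(1/2) : ℝ)..(1/2), osc t p) ^ 3 := by
  have h : ∀ p : Fin 3 → ℝ, Complex.exp (-(Complex.I * t) * (edisp p : ℂ)) = ∏ i, osc t (p i) := by
    intro p
    unfold osc edisp
    rw [← Complex.exp_sum, ← Finset.mul_sum]
    push_cast
    rfl
  unfold Kf
  simp_rw [h]
  rw [T3, volume_pi, Measure.restrict_pi_pi, integral_fintype_prod_eq_pow,
    intervalIntegral.integral_of_le (by norm_num), integral_Icc_eq_integral_Ioc]
  simp

lemma Kf_bound (t : ℝ) (ht : 0 < t) : ‖Kf t‖ ≤ 216 * t ^ (-(3/2) : ℝ) := by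
  rw [Kf_eq, norm_pow]
  calc _ ≤ (6 / Real.sqrt t)^3 := by gcongr; exact osc_bound t ht
    _ = _ := by
      rw [div_pow, Real.sqrt_eq_rpow, ← Real.rpow_natCast, ← Real.rpow_natCast, ← Real.rpow_mul ht.le,
        Real.rpow_neg ht.le]
      norm_num
      rfl

/-- The resolvent trace in the upper half plane. -/
def Gf (z : ℂ) : ℂ := ∫ q in T3, (z - (edisp q : ℂ))⁻¹

lemma Kf_meas : AEStronglyMeasurable Kf (volume.restrict (Set.Ioi 0)) := by
  have : Continuous (fun q : ℝ × (Fin 3 → ℝ) => Complex.exp (-(Complex.I * q.1) * (edisp q.2 : ℂ))) := by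
    have := edisp_cont
    fun_prop
  exact (this.stronglyMeasurable.integral_prod_right (ν := volume.restrict T3)).aestronglyMeasurable

lemma exp_int_Ioi (b : ℝ) (hb : 0 < b) :
    Integrable (fun t : ℝ => Real.exp (-b * t)) (volume.restrict (Set.Ioi 0)) := by
  exact exp_neg_integrableOn_Ioi 0 hb

lemma Gf_eq (z : ℂ) (hz : 0 < z.im) :
    Integrable (fun t : ℝ => Complex.exp (Complex.I * z * t) * Kf t) (volume.restrict (Set.Ioi 0)) ∧
    Gf z = -Complex.I * ∫ t in Set.Ioi (0:ℝ), Complex.exp (Complex.I * z * t) * Kf t := by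
  have hec := edisp_cont
  have hnorm : ∀ (t : ℝ) (q : Fin 3 → ℝ),
      ‖Complex.exp (Complex.I * (z - edisp q) * t)‖ = Real.exp (-z.im * t) := by
    intro t q
    rw [Complex.norm_exp]; congr 1; simp
  have hint : Integrable (fun x : ℝ × (Fin 3 → ℝ) => Complex.exp (Complex.I * (z - edisp x.2) * x.1))
      ((volume.restrict (Set.Ioi 0)).prod (volume.restrict T3)) := by
    have h1 : Integrable (fun x : ℝ × (Fin 3 → ℝ) => Real.exp (-z.im * x.1) * (1:ℝ))
      ((volume.restrict (Set.Ioi 0)).prod (volume.restrict T3)) :=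
      (exp_int_Ioi z.im hz).mul_prod (integrable_const (1:ℝ))
    refine h1.mono' ?_ ?_
    · exact (by fun_prop : Continuous _).aestronglyMeasurable
    · exact Eventually.of_forall fun x => by rw [hnorm, mul_one]
  have hin : ∀ t : ℝ, ∫ q in T3, Complex.exp (Complex.I * (z - edisp q) * t) =
      Complex.exp (Complex.I * z * t) * Kf t := by
    intro t
    rw [Kf, ← integral_const_mul]
    congr 1; funext q
    rw [← Complex.exp_add]; congr 1; ring
  constructor
  · have := hint.integral_prod_left
    simpa only [hin] using this
  · simp_rw [← hin]
    rw [integral_integral_swap hint, Gf, ← integral_const_mul]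
    congr 1; funext q
    have hre : (Complex.I * (z - edisp q)).re < 0 := by simp [hz]
    rw [integral_exp_mul_complex_Ioi hre]
    have hne : z - edisp q ≠ 0 := by
      intro h; rw [h] at hre; simp at hre
    have := Complex.I_ne_zero
    simp
    field_simp

lemma exp_diff (z w : ℂ) (hz : 0 < z.im) (hw : 0 < w.im) (t : ℝ) (ht : 0 < t) :
    ‖Complex.exp (Complex.I * z * t) - Complex.exp (Complex.I * w * t)‖ ≤ min 2 (t * ‖z - w‖) := by
  apply le_min
  · refine (norm_sub_le _ _).trans ?_
    have h : ∀ z : ℂ, 0 < z.im → ‖Complex.exp (Complex.I * z * t)‖ ≤ 1 := by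
      intro z hz
      rw [Complex.norm_exp, Real.exp_le_one_iff]
      simp; positivity
    linarith [h z hz, h w hw]
  · have hconv : Convex ℝ {x : ℂ | x.re ≤ 0} := convex_halfSpace_re_le 0
    have := hconv.norm_image_sub_le_of_norm_deriv_le (f := Complex.exp) (C := 1)
      (x := Complex.I * w * t) (y := Complex.I * z * t)
      (fun x _ => Complex.differentiable_exp.differentiableAt)
      (fun x hx => by
        rw [Complex.deriv_exp, Complex.norm_exp, Real.exp_le_one_iff]; exact hx)
      (by simp; positivity) (by simp; positivity)
    refine this.trans (le_of_eq ?_)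
    rw [one_mul, show Complex.I * z * t - Complex.I * w * t = Complex.I * (z - w) * t by ring]
    simp [abs_of_pos ht]; ring

lemma Gf_holder (z w : ℂ) (hz : 0 < z.im) (hw : 0 < w.im) :
    ‖Gf z - Gf w‖ ≤ 1296 * Real.sqrt ‖z - w‖ := by
  by_cases hzw : z = w
  · simp [hzw]
  set δ := ‖z - w‖ with hδ
  have hδ0 : 0 < δ := norm_pos_iff.2 (sub_ne_zero.2 hzw)
  obtain ⟨iz, ez⟩ := Gf_eq z hz
  obtain ⟨iw, ew⟩ := Gf_eq w hw
  rw [ez, ew, ← mul_sub, ← integral_sub iz iw, norm_mul, norm_neg, Complex.norm_I, one_mul]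
  set F : ℝ → ℂ := fun t => Complex.exp (Complex.I * z * t) * Kf t - Complex.exp (Complex.I * w * t) * Kf t with hF
  have hFi : IntegrableOn F (Set.Ioi 0) := iz.sub iw
  have hFb : ∀ t, 0 < t → ‖F t‖ ≤ min 2 (t * δ) * (216 * t ^ (-(3/2) : ℝ)) := by
    intro t ht
    simp only [hF]
    rw [← sub_mul, norm_mul]
    have := exp_diff z w hz hw t ht
    have := Kf_bound t ht
    gcongr
  have hT : 0 < 1/δ := by positivity
  have hsplit : Set.Ioi (0:ℝ) = Set.Ioc 0 (1/δ) ∪ Set.Ioi (1/δ) := (Set.Ioc_union_Ioi_eq_Ioi hT.le).symm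
  have h1 : ‖∫ t in Set.Ioc 0 (1/δ), F t‖ ≤ 432 * Real.sqrt δ := by
    have hi : IntervalIntegrable (fun t : ℝ => t ^ (-(1/2) : ℝ)) volume 0 (1/δ) :=
      intervalIntegral.intervalIntegrable_rpow' (by norm_num)
    have hi' : IntegrableOn (fun t : ℝ => (216 * δ) * t ^ (-(1/2) : ℝ)) (Set.Ioc 0 (1/δ)) :=
      ((intervalIntegrable_iff_integrableOn_Ioc_of_le hT.le).1 hi).const_mul _
    refine (norm_integral_le_of_norm_le hi' ?_).trans ?_
    · filter_upwards [ae_restrict_mem measurableSet_Ioc] with t ht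
      refine (hFb t ht.1).trans ?_
      have ht0 := ht.1
      calc _ ≤ (t * δ) * (216 * t ^ (-(3/2) : ℝ)) := by gcongr; exact min_le_right _ _
        _ = (216 * δ) * (t ^ (1:ℝ) * t ^ (-(3/2) : ℝ)) := by rw [Real.rpow_one]; ring
        _ = _ := by rw [← Real.rpow_add ht0]; norm_num
    · rw [integral_const_mul, ← intervalIntegral.integral_of_le hT.le,
        integral_rpow (Or.inl (by norm_num))]
      have e1 : (-(1/2) + 1 : ℝ) = 1/2 := by norm_num
      rw [e1, Real.zero_rpow (by norm_num), ← Real.sqrt_eq_rpow, Real.sqrt_div zero_le_one]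
      have hs : Real.sqrt δ ^ 2 = δ := Real.sq_sqrt hδ0.le
      have hs0 : 0 < Real.sqrt δ := Real.sqrt_pos.2 hδ0
      simp only [Real.sqrt_one, sub_zero]
      apply le_of_eq
      field_simp
      nlinarith
  have h2 : ‖∫ t in Set.Ioi (1/δ), F t‖ ≤ 864 * Real.sqrt δ := by
    have hi' : IntegrableOn (fun t : ℝ => (432:ℝ) * t ^ (-(3/2) : ℝ)) (Set.Ioi (1/δ)) :=
      (integrableOn_Ioi_rpow_of_lt (by norm_num) hT).const_mul _
    refine (norm_integral_le_of_norm_le hi' ?_).trans ?_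
    · filter_upwards [ae_restrict_mem measurableSet_Ioi] with t ht
      have ht0 : 0 < t := hT.trans ht
      refine (hFb t ht0).trans ?_
      calc _ ≤ 2 * (216 * t ^ (-(3/2) : ℝ)) := by gcongr; exact min_le_left _ _
        _ = _ := by ring
    · rw [integral_const_mul, integral_Ioi_rpow_of_lt (by norm_num) hT]
      have e1 : (-(3/2) + 1 : ℝ) = -(1/2) := by norm_num
      rw [e1, Real.rpow_neg hT.le, ← Real.sqrt_eq_rpow, Real.sqrt_div zero_le_one]
      simp only [Real.sqrt_one]
      apply le_of_eq
      field_simp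
      norm_num
  rw [hsplit, setIntegral_union Set.Ioc_disjoint_Ioi_same measurableSet_Ioi
    (hFi.mono_set Set.Ioc_subset_Ioi_self) (hFi.mono_set (Set.Ioi_subset_Ioi hT.le))]
  refine (norm_add_le _ _).trans ?_
  linarith

lemma sub_edisp_im (z : ℂ) (q : Fin 3 → ℝ) : (z - edisp q).im = z.im := by simp

lemma im_le_norm (z : ℂ) (_hz : 0 < z.im) (q : Fin 3 → ℝ) : z.im ≤ ‖z - edisp q‖ := by
  have := Complex.abs_im_le_norm (z - edisp q)
  rw [sub_edisp_im] at this
  exact (le_abs_self _).trans this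

lemma inv_bound (z : ℂ) (hz : 0 < z.im) (q : Fin 3 → ℝ) : ‖(z - edisp q)⁻¹‖ ≤ 1 / z.im := by
  rw [norm_inv, ← one_div]
  exact one_div_le_one_div_of_le hz (im_le_norm z hz q)

lemma ne_zero' (z : ℂ) (hz : 0 < z.im) (q : Fin 3 → ℝ) : z - edisp q ≠ 0 := by
  intro h
  have := im_le_norm z hz q
  rw [h] at this; simp at this; linarith

lemma inv_integrable (z : ℂ) (hz : 0 < z.im) :
    Integrable (fun q => (z - edisp q)⁻¹) (volume.restrict T3) := by
  have hec := edisp_cont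
  have : Continuous (fun q => (z - edisp q)⁻¹) :=
    Continuous.inv₀ (by fun_prop) (ne_zero' z hz)
  exact Integrable.of_bound this.aestronglyMeasurable (1/z.im) (Eventually.of_forall (inv_bound z hz))

lemma Gf_norm (z : ℂ) (hz : 0 < z.im) : ‖Gf z‖ ≤ 1297 := by
  have h1 := Gf_holder z (z + Complex.I) hz (by simp; linarith)
  simp only [sub_add_cancel_left, norm_neg, Complex.norm_I, Real.sqrt_one] at h1
  have h2 : ‖Gf (z + Complex.I)‖ ≤ 1 := by
    have hi : 1 ≤ (z + Complex.I).im := by simp; linarith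
    have := norm_integral_le_of_norm_le_const (μ := volume.restrict T3) (C := 1)
      (f := fun q => (z + Complex.I - edisp q)⁻¹)
      (Eventually.of_forall fun q => (inv_bound _ (by linarith) q).trans
        (by rw [div_le_one (by linarith)]; exact hi))
    simpa [Gf] using this
  have := norm_sub_norm_le (Gf z) (Gf (z + Complex.I))
  linarith

lemma Gf_im (z : ℂ) (hz : 0 < z.im) :
    Integrable (fun q => 1 / ‖z - edisp q‖^2) (volume.restrict T3) ∧
    ∫ q in T3, 1 / ‖z - edisp q‖^2 = -(Gf z).im / z.im := by
  have hi := inv_integrable z hz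
  have he : ∀ q, 1 / ‖z - edisp q‖^2 = -(1/z.im) * ((z - edisp q)⁻¹).im := by
    intro q
    rw [Complex.inv_im, sub_edisp_im, Complex.normSq_eq_norm_sq]
    field_simp
  simp_rw [he]
  constructor
  · exact hi.im.const_mul _
  · rw [integral_const_mul]
    have := integral_im hi
    simp only [RCLike.im_to_complex] at this
    rw [this, Gf]
    ring

lemma Gf_im_nonpos (z : ℂ) (hz : 0 < z.im) : (Gf z).im ≤ 0 := by
  have h := (Gf_im z hz).2
  have h2 : 0 ≤ ∫ q in T3, 1 / ‖z - edisp q‖^2 := integral_nonneg fun q => by positivity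
  rw [h, le_div_iff₀ hz] at h2
  linarith

lemma ThetaEps_eq (ε α : ℝ) : ThetaEps ε α = Gf (α + ε * Complex.I) := by
  unfold ThetaEps Gf
  congr 1; funext q; congr 1; ring

lemma Theta_tendsto {Θ : ℝ → ℂ} (h : IsThetaLimit Θ) (α : ℝ) :
    Tendsto (fun ε : ℝ => Gf (α + ε * Complex.I)) (𝓝[>] (0 : ℝ)) (𝓝 (Θ α)) := by
  simpa only [ThetaEps_eq] using h α

lemma Theta_im {Θ : ℝ → ℂ} (h : IsThetaLimit Θ) (α : ℝ) : (Θ α).im ≤ 0 := by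
  refine le_of_tendsto ((Complex.continuous_im.tendsto _).comp (Theta_tendsto h α)) ?_
  filter_upwards [self_mem_nhdsWithin] with ε hε
  exact Gf_im_nonpos _ (by simpa using hε)

lemma Theta_norm {Θ : ℝ → ℂ} (h : IsThetaLimit Θ) (α : ℝ) : ‖Θ α‖ ≤ 1297 := by
  refine le_of_tendsto (Theta_tendsto h α).norm ?_
  filter_upwards [self_mem_nhdsWithin] with ε hε
  exact Gf_norm _ (by simpa using hε)

lemma aux_tendsto (α : ℝ) :
    Tendsto (fun ε : ℝ => (α + ε * Complex.I : ℂ)) (𝓝[>] (0 : ℝ)) (𝓝 (α : ℂ)) := by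
  have : Continuous (fun ε : ℝ => (α + ε * Complex.I : ℂ)) := by fun_prop
  have h := this.tendsto 0
  simp only [Complex.ofReal_zero, zero_mul, add_zero] at h
  exact h.mono_left nhdsWithin_le_nhds

lemma Theta_Gf {Θ : ℝ → ℂ} (h : IsThetaLimit Θ) (α : ℝ) (z : ℂ) (hz : 0 < z.im) :
    ‖Gf z - Θ α‖ ≤ 1296 * Real.sqrt ‖z - α‖ := by
  have hr : Tendsto (fun ε : ℝ => 1296 * Real.sqrt ‖z - (α + ε * Complex.I)‖) (𝓝[>] (0 : ℝ))
      (𝓝 (1296 * Real.sqrt ‖z - α‖)) :=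
    ((Real.continuous_sqrt.tendsto _).comp ((aux_tendsto α).const_sub z).norm).const_mul _
  refine le_of_tendsto_of_tendsto ((Theta_tendsto h α).const_sub (Gf z)).norm hr ?_
  filter_upwards [self_mem_nhdsWithin] with ε hε
  exact Gf_holder _ _ hz (by simpa using hε)

lemma Theta_holder {Θ : ℝ → ℂ} (h : IsThetaLimit Θ) (α β : ℝ) :
    ‖Θ α - Θ β‖ ≤ 1296 * Real.sqrt |α - β| := by
  have hr : Tendsto (fun ε : ℝ => 1296 * Real.sqrt ‖(α + ε * Complex.I) - (β : ℂ)‖) (𝓝[>] (0 : ℝ))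
      (𝓝 (1296 * Real.sqrt ‖(α : ℂ) - β‖)) :=
    ((Real.continuous_sqrt.tendsto _).comp ((aux_tendsto α).sub_const (β:ℂ)).norm).const_mul _
  have e : ‖(α : ℂ) - β‖ = |α - β| := by
    rw [← Complex.ofReal_sub, Complex.norm_real, Real.norm_eq_abs]
  rw [← e]
  refine le_of_tendsto_of_tendsto ((Theta_tendsto h α).sub_const (Θ β)).norm hr ?_
  filter_upwards [self_mem_nhdsWithin] with ε hε
  exact Theta_Gf h β _ (by simpa using hε)

/-- the elementary comparison of inverse squares -/
lemma inv_sq_compare (a b D l η H M : ℝ) (hl : 0 < l) (hη : 0 < η) (hH : 0 ≤ H) (hM : 0 ≤ M)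
    (hlD : l^2 ≤ D) (ha : η ≤ a) (hb : η ≤ b)
    (hDa : D ≤ (M + 3) * (l^2/η) * a) (hDb : D ≤ (M + 3) * (l^2/η) * b)
    (hab : b - a ≤ l^2 * (H * Real.sqrt D)) :
    l^2 / a^2 ≤ l^2 / b^2 + 2 * H * (M+3)^3 * (l^9/η^3) / D^2 := by
  have ha0 : 0 < a := hη.trans_le ha
  have hb0 : 0 < b := hη.trans_le hb
  have hD0 : 0 < D := lt_of_lt_of_le (by positivity) hlD
  set k := (M + 3) * (l^2/η) with hk
  have hk0 : 0 < k := by positivity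
  have hia : 1 / a ≤ k / D := by rw [div_le_div_iff₀ ha0 hD0]; linarith
  have hib : 1 / b ≤ k / D := by rw [div_le_div_iff₀ hb0 hD0]; linarith
  have hsq : l * Real.sqrt D ≤ D := by
    have h1 : l ≤ Real.sqrt D := Real.le_sqrt_of_sq_le hlD
    have h2 : Real.sqrt D * Real.sqrt D = D := Real.mul_self_sqrt hD0.le
    nlinarith [Real.sqrt_nonneg D]
  have e1 : 1 / a^2 - 1 / b^2 = (b - a) * ((1/a) * (1/b) * (1/b) + (1/a) * (1/a) * (1/b)) := by
    field_simp; ring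
  have p1 : (1/a) * (1/b) * (1/b) ≤ (k/D) * (k/D) * (k/D) := by gcongr
  have p2 : (1/a) * (1/a) * (1/b) ≤ (k/D) * (k/D) * (k/D) := by gcongr
  have h3 : 1 / a^2 - 1 / b^2 ≤ (l^2 * (H * Real.sqrt D)) * (2 * (k/D)^3) := by
    rw [e1]
    calc _ ≤ (l^2 * (H * Real.sqrt D)) * ((1/a) * (1/b) * (1/b) + (1/a) * (1/a) * (1/b)) := by gcongr
      _ ≤ _ := by gcongr; linarith
  have h4 : l^2 * ((l^2 * (H * Real.sqrt D)) * (2 * (k/D)^3)) =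
      (2 * H * k^3 * l^3 / D^3) * (l * Real.sqrt D) := by ring
  have h5 : (2 * H * k^3 * l^3 / D^3) * (l * Real.sqrt D) ≤ (2 * H * k^3 * l^3 / D^3) * D := by gcongr
  have h6 : (2 * H * k^3 * l^3 / D^3) * D = 2 * H * (M+3)^3 * (l^9/η^3) / D^2 := by
    rw [hk]; field_simp
  have h7 := mul_le_mul_of_nonneg_left h3 (by positivity : 0 ≤ l^2)
  have e2 : l^2 / a^2 = l^2 / b^2 + l^2 * (1/a^2 - 1/b^2) := by ring
  rw [e2]; linarith

/-- lower bound of the denominators -/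
lemma denom_lower (A : ℂ) (x l η M : ℝ) (T : ℂ) (hη : 0 < η) (hηl : η ≤ l^2)
    (hM : 0 ≤ M) (hT : ‖T‖ ≤ M) (hTi : T.im ≤ 0)
    (hA : A = x - (l:ℂ)^2 * (starRingEnd ℂ) T - η * Complex.I) :
    η ≤ ‖A‖ ∧ |x| + l^2 ≤ (M+3) * (l^2/η) * ‖A‖ := by
  have him : A.im = l^2 * T.im - η := by
    rw [hA, ← Complex.ofReal_pow]
    simp [-Complex.ofReal_pow]
  have h1 : η ≤ ‖A‖ := by
    have := Complex.abs_im_le_norm A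
    rw [him] at this
    have h2 : l^2 * T.im ≤ 0 := mul_nonpos_of_nonneg_of_nonpos (by positivity) hTi
    have h3 := neg_abs_le (l^2 * T.im - η)
    linarith
  refine ⟨h1, ?_⟩
  have h2 : |x| ≤ ‖A‖ + l^2 * M + η := by
    have e : (x : ℂ) = A + (l:ℂ)^2 * (starRingEnd ℂ) T + η * Complex.I := by rw [hA]; ring
    have e2 : |x| = ‖(x:ℂ)‖ := by simp
    rw [e2, e]
    refine (norm_add_le _ _).trans ?_
    have n1 : ‖(η:ℂ) * Complex.I‖ = η := by simp [abs_of_pos hη]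
    rw [n1]
    have n2 : ‖(l:ℂ)^2 * (starRingEnd ℂ) T‖ ≤ l^2 * M := by
      rw [norm_mul]; simp; gcongr
    linarith [norm_add_le A ((l:ℂ)^2 * (starRingEnd ℂ) T)]
  have h3 : l^2 ≤ (l^2/η) * ‖A‖ := by
    rw [div_mul_eq_mul_div, le_div_iff₀ hη]; gcongr
  have h4 : ‖A‖ ≤ (l^2/η) * ‖A‖ := by
    have : 1 ≤ l^2/η := by rw [one_le_div hη]; exact hηl
    nlinarith [norm_nonneg A]
  nlinarith

/-- The explicit constant. -/
def Cz : ℝ := 1296 * 1298 + 2 * 1296 * 1300^3 * 1297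

lemma main_i {Θ : ℝ → ℂ} (h : IsThetaLimit Θ) (l η : ℝ) (hl : 0 < l) (hη : 0 < η)
    (hηl : η ≤ l^2) (α : ℝ) :
    (∫ p in T3, l ^ 2 / ‖(α : ℂ) - (starRingEnd ℂ) (omegaR Θ l p) - (η : ℂ) * Complex.I‖ ^ 2) ≤
      1 + Cz * (l^7 / η^3) := by
  set z : ℂ := α - (l:ℂ)^2 * Θ α + η * Complex.I with hz
  have hl2 : 0 < l^2 := by positivity
  have hzim : z.im = η - l^2 * (Θ α).im := by
    rw [hz, ← Complex.ofReal_pow]; simp [-Complex.ofReal_pow]; ring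
  have hTim := Theta_im h α
  have hzη : η ≤ z.im := by rw [hzim]; nlinarith
  have hz0 : 0 < z.im := hη.trans_le hzη
  set y : ℂ := α + (l^2 : ℝ) * Complex.I with hy
  have hyim : y.im = l^2 := by rw [hy]; simp [-Complex.ofReal_pow]
  have hy0 : 0 < y.im := by rw [hyim]; exact hl2
  obtain ⟨i1, e1⟩ := Gf_im z hz0
  obtain ⟨i2, e2⟩ := Gf_im y hy0
  set E : ℝ := 2 * 1296 * (1297+3)^3 * (l^9/η^3) with hE
  have hE0 : 0 ≤ E := by positivity
  have hpt : ∀ p, l ^ 2 / ‖(α : ℂ) - (starRingEnd ℂ) (omegaR Θ l p) - (η : ℂ) * Complex.I‖ ^ 2 ≤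
      l^2 * (1 / ‖z - edisp p‖^2) + E * (1 / ‖y - edisp p‖^2) := by
    intro p
    set A := (α : ℂ) - (starRingEnd ℂ) (omegaR Θ l p) - (η : ℂ) * Complex.I with hA
    set B : ℂ := ((α - edisp p : ℝ) : ℂ) - (l:ℂ)^2 * (starRingEnd ℂ) (Θ α) - η * Complex.I with hB
    have hA' : A = ((α - edisp p : ℝ) : ℂ) - (l:ℂ)^2 * (starRingEnd ℂ) (Θ (edisp p)) - η * Complex.I := by
      rw [hA, omegaR]; simp; ring
    obtain ⟨a1, a2⟩ := denom_lower A (α - edisp p) l η 1297 _ hη hηl (by norm_num)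
      (Theta_norm h _) (Theta_im h _) hA'
    obtain ⟨b1, b2⟩ := denom_lower B (α - edisp p) l η 1297 _ hη hηl (by norm_num)
      (Theta_norm h _) (Theta_im h _) hB
    have hBz : ‖B‖ = ‖z - edisp p‖ := by
      rw [← Complex.norm_conj B]; congr 1
      rw [hB, hz]; simp; ring
    have hab : ‖B‖ - ‖A‖ ≤ l^2 * (1296 * Real.sqrt (|α - edisp p| + l^2)) := by
      refine (norm_sub_norm_le _ _).trans ?_
      have : B - A = (l:ℂ)^2 * (starRingEnd ℂ) (Θ (edisp p) - Θ α) := by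
        rw [hA', hB, map_sub]; ring
      rw [this, norm_mul, Complex.norm_conj, norm_sub_rev, norm_pow, Complex.norm_real,
        Real.norm_of_nonneg hl.le]
      have t1 := Theta_holder h α (edisp p)
      have t2 : Real.sqrt |α - edisp p| ≤ Real.sqrt (|α - edisp p| + l^2) :=
        Real.sqrt_le_sqrt (by linarith)
      gcongr
      linarith
    have hmain := inv_sq_compare ‖A‖ ‖B‖ (|α - edisp p| + l^2) l η 1296 1297 hl hη (by norm_num)
      (by norm_num) (by linarith [abs_nonneg (α - edisp p)]) a1 b1 a2 b2 hab
    have hyn : ‖y - edisp p‖ ≤ |α - edisp p| + l^2 := by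
      have : y - edisp p = ((α - edisp p : ℝ) : ℂ) + ((l^2 : ℝ) : ℂ) * Complex.I := by
        rw [hy]; push_cast; ring
      rw [this]
      refine (norm_add_le _ _).trans ?_
      rw [norm_mul, Complex.norm_I, mul_one, Complex.norm_real, Complex.norm_real,
        Real.norm_eq_abs, Real.norm_of_nonneg hl2.le]
    have hyp : 0 < ‖y - edisp p‖ := norm_pos_iff.2 (ne_zero' y hy0 p)
    rw [← hE] at hmain
    refine hmain.trans ?_
    rw [hBz]
    have : E / (|α - edisp p| + l^2)^2 ≤ E * (1 / ‖y - edisp p‖^2) := by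
      rw [mul_one_div]; gcongr
    have e : l^2 * (1 / ‖z - edisp p‖^2) = l^2 / ‖z - edisp p‖^2 := by ring
    rw [e]
    linarith
  have hint : (∫ p in T3, l ^ 2 / ‖(α : ℂ) - (starRingEnd ℂ) (omegaR Θ l p) - (η : ℂ) * Complex.I‖ ^ 2) ≤
      l^2 * (-(Gf z).im / z.im) + E * (-(Gf y).im / y.im) := by
    rw [← e1, ← e2, ← integral_const_mul, ← integral_const_mul,
      ← integral_add (i1.const_mul _) (i2.const_mul _)]
    apply integral_mono_of_nonneg
    · exact Eventually.of_forall fun p => by simp only [Pi.zero_apply]; positivity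
    · exact (i1.const_mul _).add (i2.const_mul _)
    · exact Eventually.of_forall hpt
  refine hint.trans ?_
  -- first term
  have t1 : l^2 * (-(Gf z).im / z.im) ≤ 1 + 1296 * 1298 * (l^7/η^3) := by
    have g1 := Theta_Gf h α z hz0
    have g2 : ‖z - α‖ ≤ 1298 * l^2 := by
      have : z - α = η * Complex.I - (l:ℂ)^2 * Θ α := by rw [hz]; ring
      rw [this]
      refine (norm_sub_le _ _).trans ?_
      have n1 : ‖(η:ℂ) * Complex.I‖ = η := by simp [abs_of_pos hη]
      have n2 : ‖(l:ℂ)^2 * Θ α‖ ≤ l^2 * 1297 := by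
        rw [norm_mul]; simp; gcongr; exact Theta_norm h α
      linarith
    have g3 : Real.sqrt ‖z - α‖ ≤ 1298 * l := by
      rw [Real.sqrt_le_left (by positivity)]
      nlinarith
    have g4 : -(Gf z).im ≤ -(Θ α).im + 1296 * (1298 * l) := by
      have := (Complex.abs_im_le_norm (Gf z - Θ α)).trans g1
      rw [Complex.sub_im] at this
      have := neg_abs_le ((Gf z).im - (Θ α).im)
      nlinarith
    have g5 : l^3 / η ≤ l^7 / η^3 := by
      rw [div_le_div_iff₀ hη (by positivity)]
      have : η^2 ≤ (l^2)^2 := by gcongr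
      have : l^3 * η * η^2 ≤ l^3 * η * (l^2)^2 := by gcongr
      nlinarith
    have g6 : l^2 * (-(Gf z).im / z.im) ≤ 1 + 1296 * 1298 * (l^3/η) := by
      rw [← mul_div_assoc, div_le_iff₀ hz0]
      have : 1296 * 1298 * l^3 ≤ 1296 * 1298 * (l^3/η) * z.im := by
        have : l^3 = (l^3/η) * η := by field_simp
        have q : (l^3/η) * η ≤ (l^3/η) * z.im := by gcongr
        nlinarith
      have q2 := mul_le_mul_of_nonneg_left g4 hl2.le
      nlinarith
    linarith
  have t2 : E * (-(Gf y).im / y.im) ≤ 2 * 1296 * 1300^3 * 1297 * (l^7/η^3) := by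
    have : -(Gf y).im ≤ 1297 := by
      have := (Complex.abs_im_le_norm (Gf y)).trans (Gf_norm y hy0)
      linarith [neg_abs_le (Gf y).im]
    rw [hyim]
    calc _ ≤ E * (1297 / l^2) := by gcongr
      _ = _ := by rw [hE]; field_simp; norm_num
  rw [Cz]
  linarith

lemma omega_periodic (Θ : ℝ → ℂ) (l : ℝ) (p v : Fin 3 → ℝ) (hv : ∀ j, ∃ n : ℤ, v j = n) :
    omegaR Θ l (v + p) = omegaR Θ l p := by
  have : edisp (v + p) = edisp p := by
    unfold edisp
    refine Finset.sum_congr rfl fun j _ => ?_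
    obtain ⟨n, hn⟩ := hv j
    rw [Pi.add_apply, hn, show 2 * Real.pi * (n + p j) = 2 * Real.pi * p j + n * (2 * Real.pi) by ring,
      Real.cos_add_int_mul_two_pi]
  unfold omegaR
  rw [this]

open Pointwise in
lemma trans_inv (f : (Fin 3 → ℝ) → ℝ)
    (hf : ∀ p v : Fin 3 → ℝ, (∀ j, ∃ n : ℤ, v j = n) → f (v + p) = f p) (r : Fin 3 → ℝ) :
    ∫ p in T3, f (p + r) = ∫ p in T3, f p := by
  set F : Set (Fin 3 → ℝ) := ZSpan.fundamentalDomain (Pi.basisFun ℝ (Fin 3)) with hF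
  have hFD := ZSpan.isAddFundamentalDomain' (Pi.basisFun ℝ (Fin 3)) (volume : Measure (Fin 3 → ℝ))
  set c : Fin 3 → ℝ := fun _ => -(1/2) with hc
  have hT : T3 =ᵐ[volume] (c +ᵥ F : Set (Fin 3 → ℝ)) := by
    have e : (c +ᵥ F : Set (Fin 3 → ℝ)) = Set.pi Set.univ fun _ => Set.Ico (-(1/2) : ℝ) (1/2) := by
      ext x
      rw [Set.mem_vadd_set_iff_neg_vadd_mem, hF, ZSpan.fundamentalDomain_pi_basisFun]
      simp only [Set.mem_pi, Set.mem_univ, true_imp_iff, Set.mem_Ico, vadd_eq_add, Pi.add_apply, Pi.neg_apply, hc]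
      refine forall_congr' fun i => ?_
      constructor <;> rintro ⟨h1, h2⟩ <;> constructor <;> linarith
    rw [e, T3]
    exact (Measure.pi_Ico_ae_eq_pi_Icc).symm
  have hper : ∀ (g : (Submodule.span ℤ (Set.range (Pi.basisFun ℝ (Fin 3)))).toAddSubgroup) (x : Fin 3 → ℝ),
      f (g +ᵥ x) = f x := by
    intro g x
    refine hf x g fun j => ?_
    have := (Module.Basis.mem_span_iff_repr_mem ℤ (Pi.basisFun ℝ (Fin 3)) (g : Fin 3 → ℝ)).1 g.2 j
    obtain ⟨n, hn⟩ := this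
    exact ⟨n, by simpa using hn.symm⟩
  rw [setIntegral_congr_set hT, setIntegral_congr_set hT]
  have hcount : Countable (Submodule.span ℤ (Set.range (Pi.basisFun ℝ (Fin 3)))).toAddSubgroup :=
    inferInstanceAs (Countable (Submodule.span ℤ (Set.range (Pi.basisFun ℝ (Fin 3)))))
  have h1 := hFD.vadd_of_comm c
  have h2 := hFD.vadd_of_comm (r + c)
  rw [h1.setIntegral_eq h2 hper]
  have mp := measurePreserving_add_right (volume : Measure (Fin 3 → ℝ)) r
  rw [← mp.setIntegral_preimage_emb (measurableEmbedding_addRight r) f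
    ((r + c) +ᵥ ZSpan.fundamentalDomain (Pi.basisFun ℝ (Fin 3)))]
  congr 2
  ext x
  rw [Set.mem_preimage, Set.mem_vadd_set_iff_neg_vadd_mem, Set.mem_vadd_set_iff_neg_vadd_mem]
  congr! 1
  simp only [vadd_eq_add]; abel

lemma Theta_cont {Θ : ℝ → ℂ} (h : IsThetaLimit Θ) : Continuous Θ := by
  rw [continuous_iff_continuousAt]
  intro α
  rw [ContinuousAt, tendsto_iff_norm_sub_tendsto_zero]
  have hr : Tendsto (fun β : ℝ => 1296 * Real.sqrt |β - α|) (𝓝 α) (𝓝 0) := by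
    have : Continuous (fun β : ℝ => 1296 * Real.sqrt |β - α|) := by fun_prop
    simpa using this.tendsto α
  exact squeeze_zero (fun _ => norm_nonneg _) (fun β => Theta_holder h β α) hr

/-- the denominator appearing in the theorem -/
def Den (Θ : ℝ → ℂ) (l η α : ℝ) (p : Fin 3 → ℝ) : ℝ :=
  ‖(α : ℂ) - (starRingEnd ℂ) (omegaR Θ l p) - (η : ℂ) * Complex.I‖

lemma Den_cont {Θ : ℝ → ℂ} (h : IsThetaLimit Θ) (l η α : ℝ) : Continuous (Den Θ l η α) := by
  have h1 := Theta_cont h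
  have h2 := edisp_cont
  have h3 : Continuous (omegaR Θ l) := by unfold omegaR; fun_prop
  have h4 := Complex.continuous_conj.comp h3
  exact ((continuous_const.sub h4).sub continuous_const).norm

lemma Den_lower {Θ : ℝ → ℂ} (h : IsThetaLimit Θ) (l η α : ℝ) (hη : 0 < η)
    (hηl : η ≤ l^2) (p : Fin 3 → ℝ) : η ≤ Den Θ l η α p := by
  refine (denom_lower _ (α - edisp p) l η 1297 (Θ (edisp p)) hη hηl (by norm_num)
      (Theta_norm h _) (Theta_im h _) ?_).1
  rw [omegaR]; simp; ring

lemma Den_integrable {Θ : ℝ → ℂ} (h : IsThetaLimit Θ) (l η α : ℝ) (hη : 0 < η)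
    (hηl : η ≤ l^2) (r : Fin 3 → ℝ) :
    Integrable (fun p => l^2 / Den Θ l η α (p + r) ^ 2) (volume.restrict T3) := by
  have hlow := Den_lower h l η α hη hηl
  have hc : Continuous (fun p => l^2 / Den Θ l η α (p + r) ^ 2) := by
    have := Den_cont h l η α
    refine Continuous.div (by fun_prop) (by fun_prop) fun p => ?_
    exact pow_ne_zero _ (hη.trans_le (hlow _)).ne'
  refine Integrable.of_bound hc.aestronglyMeasurable (l^2/η^2) (Eventually.of_forall fun p => ?_)
  rw [Real.norm_of_nonneg (by positivity)]
  gcongr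
  exact hlow _

lemma Den_trans {Θ : ℝ → ℂ} (h : IsThetaLimit Θ) (l η α : ℝ) (hl : 0 < l) (hη : 0 < η)
    (hηl : η ≤ l^2) (r : Fin 3 → ℝ) :
    ∫ p in T3, l^2 / Den Θ l η α (p + r) ^ 2 ≤ 1 + Cz * (l^7 / η^3) := by
  rw [trans_inv (fun p => l^2 / Den Θ l η α p ^ 2) ?_ r]
  · exact main_i h l η hl hη hηl α
  · intro p v hv
    simp only [Den]
    rw [omega_periodic Θ l p v hv]

lemma main_ii {Θ : ℝ → ℂ} (h : IsThetaLimit Θ) (l η : ℝ) (hl : 0 < l) (hη : 0 < η)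
    (hηl : η ≤ l^2) (α β : ℝ) (r : Fin 3 → ℝ) :
    (∫ p in T3, l ^ 2 /
        (‖(α : ℂ) - (starRingEnd ℂ) (omegaR Θ l (p + r)) - (η : ℂ) * Complex.I‖ *
          ‖(β : ℂ) - omegaR Θ l (p - r) + (η : ℂ) * Complex.I‖)) ≤
      1 + Cz * (l^7 / η^3) := by
  have hconj : ∀ p, ‖(β : ℂ) - omegaR Θ l (p - r) + (η : ℂ) * Complex.I‖ = Den Θ l η β (p + -r) := by
    intro p
    rw [Den, ← Complex.norm_conj, sub_eq_add_neg p r]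
    congr 1
    simp
    ring
  have i1 := Den_integrable h l η α hη hηl r
  have i2 := Den_integrable h l η β hη hηl (-r)
  have j1 := Den_trans h l η α hl hη hηl r
  have j2 := Den_trans h l η β hl hη hηl (-r)
  calc _ ≤ ∫ p in T3, ((1/2) * (l^2 / Den Θ l η α (p + r) ^ 2) +
          (1/2) * (l^2 / Den Θ l η β (p + -r) ^ 2)) := by
        apply integral_mono_of_nonneg
        · exact Eventually.of_forall fun p => by simp only [Pi.zero_apply]; positivity
        · exact (i1.const_mul _).add (i2.const_mul _)
        · refine Eventually.of_forall fun p => ?_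
          simp only [hconj]
          change l^2 / (Den Θ l η α (p + r) * Den Θ l η β (p + -r)) ≤ _
          have a0 := hη.trans_le (Den_lower h l η α hη hηl (p + r))
          have b0 := hη.trans_le (Den_lower h l η β hη hηl (p + -r))
          generalize Den Θ l η α (p + r) = a at *
          generalize Den Θ l η β (p + -r) = b at *
          have e : (1/2) * (l^2/a^2) + (1/2) * (l^2/b^2) - l^2/(a*b) = (l^2/2) * (1/a - 1/b)^2 := by
            field_simp; ring
          have : 0 ≤ (l^2/2) * (1/a - 1/b)^2 := by positivity
          linarith
    _ ≤ _ := by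
        rw [integral_add (i1.const_mul _) (i2.const_mul _), integral_const_mul, integral_const_mul]
        linarith

lemma Cz_pos : 0 < Cz := by unfold Cz; norm_num

lemma rate (κ l η : ℝ) (hl : 0 < l) (h : l ^ (2 + 4 * κ) ≤ η) :
    l^7 / η^3 ≤ l ^ (1 - 12 * κ) := by
  have h0 : 0 < l ^ (2 + 4 * κ) := Real.rpow_pos_of_pos hl _
  have h1 : l^7 / η^3 ≤ l^7 / (l ^ (2 + 4 * κ))^3 := by gcongr
  refine h1.trans (le_of_eq ?_)
  rw [← Real.rpow_natCast, ← Real.rpow_natCast, ← Real.rpow_mul hl.le, ← Real.rpow_sub hl]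
  congr 1
  push_cast; ring

/-- For `0 < κ ≤ 1/12` there are a universal `C₀ > 0` and `λ₀ > 0` such that
for `0 < λ ≤ λ₀` and `λ^{2+4κ} ≤ η ≤ λ²`:
(i) `sup_α ∫ λ² dp / |α - ω̄(p) - iη|² ≤ 1 + C₀ λ^{1-12κ}`;
(ii) `sup_{α,β,r} ∫ λ² dp / (|α - ω̄(p+r) - iη| |β - ω(p-r) + iη|) ≤ 1 + C₀ λ^{1-12κ}`. -/
theorem statement7 (κ : ℝ) (hκ0 : 0 < κ) (hκ : κ ≤ 1/12) :
    ∃ C₀ lam0 : ℝ, 0 < C₀ ∧ 0 < lam0 ∧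
      ∀ Θ : ℝ → ℂ, IsThetaLimit Θ →
        ∀ lam : ℝ, 0 < lam → lam ≤ lam0 →
          ∀ η : ℝ, lam ^ (2 + 4 * κ) ≤ η → η ≤ lam ^ 2 →
            (∀ α : ℝ,
              (∫ p in T3,
                  lam ^ 2 /
                    ‖(α : ℂ) - (starRingEnd ℂ) (omegaR Θ lam p) - (η : ℂ) * Complex.I‖ ^ 2) ≤
                1 + C₀ * lam ^ (1 - 12 * κ)) ∧
            (∀ α β : ℝ, ∀ r : Fin 3 → ℝ,
              (∫ p in T3,
                  lam ^ 2 /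
                    (‖(α : ℂ) - (starRingEnd ℂ) (omegaR Θ lam (p + r)) - (η : ℂ) * Complex.I‖ *
                      ‖(β : ℂ) - omegaR Θ lam (p - r) + (η : ℂ) * Complex.I‖)) ≤
                1 + C₀ * lam ^ (1 - 12 * κ)) := by
  refine ⟨Cz, 1, Cz_pos, one_pos, ?_⟩
  intro Θ h lam hl _ η hη1 hη2
  have hη : 0 < η := (Real.rpow_pos_of_pos hl _).trans_le hη1
  have hr : 1 + Cz * (lam^7/η^3) ≤ 1 + Cz * lam ^ (1 - 12 * κ) := by
    have := mul_le_mul_of_nonneg_left (rate κ lam η hl hη1) Cz_pos.le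
    linarith
  exact ⟨fun α => (main_i h lam η hl hη hη2 α).trans hr,
    fun α β r => (main_ii h lam η hl hη hη2 α β r).trans hr⟩

end
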